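/- arXiv:1707.08086 — 2 statements merged into one kernel-verified Lean document; each statement's English description precedes it below -/
import Mathlib

section
/- For every t ≥ 0 and every δ with 0 ≤ δ ≤ 1, the standard Gaussian tail satisfies Q(t) ≤ Q(δ·t) ≤ Q(t)^{δ²}. -/
open MeasureTheory ProbabilityTheory Real

/-- Standard Gaussian upper tail probability. -/
noncomputable def Q (t : ℝ) : ℝ := ((gaussianReal 0 1) (Set.Ioi t)).toReal

/-- The standard Gaussian density. -/
noncomputable def phi (x : ℝ) : ℝ := gaussianPDFReal 0 1 x

lemma phi_eq (x : ℝ) : phi x = (√(2 * π))⁻¹ * exp (-x ^ 2 / 2) := by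
  simp [phi, gaussianPDFReal]

lemma phi_pos (x : ℝ) : 0 < phi x := gaussianPDFReal_pos 0 1 x one_ne_zero

lemma phi_hasDerivAt (x : ℝ) : HasDerivAt phi (-x * phi x) x := by
  have h1 : HasDerivAt (fun y : ℝ => -y ^ 2 / 2) (-x) x := by
    have := ((hasDerivAt_pow 2 x).neg).div_const 2
    refine this.congr_deriv ?_
    simp
    ring
  have h := (h1.exp).const_mul (√(2 * π))⁻¹
  have e : phi = fun y => (√(2 * π))⁻¹ * exp (-y ^ 2 / 2) := funext phi_eq
  rw [e]
  refine h.congr_deriv ?_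
  ring

lemma phi_cont : Continuous phi :=
  continuous_iff_continuousAt.2 fun x => (phi_hasDerivAt x).continuousAt

lemma phi_integrable : Integrable phi := integrable_gaussianPDFReal 0 1

lemma Q_eq (t : ℝ) : Q t = ∫ x in Set.Ioi t, phi x := by
  unfold Q
  rw [gaussianReal_apply_eq_integral 0 one_ne_zero, ENNReal.toReal_ofReal]
  · rfl
  · exact integral_nonneg fun x => (phi_pos x).le

lemma Q_pos (t : ℝ) : 0 < Q t := by
  unfold Q
  apply ENNReal.toReal_pos _ (measure_ne_top _ _)
  intro h
  have := gaussianReal_absolutelyContinuous' 0 (v := 1) one_ne_zero h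
  simp at this

lemma Q_le_one (t : ℝ) : Q t ≤ 1 := by
  unfold Q
  exact measureReal_le_one

lemma Q_anti {s t : ℝ} (h : s ≤ t) : Q t ≤ Q s := by
  unfold Q
  exact ENNReal.toReal_mono (measure_ne_top _ _) (measure_mono (Set.Ioi_subset_Ioi h))

lemma Q_eq_sub (t : ℝ) : Q t = Q 0 - ∫ x in (0:ℝ)..t, phi x := by
  rw [Q_eq, Q_eq, ← intervalIntegral.integral_Ioi_sub_Ioi'
    phi_integrable.integrableOn phi_integrable.integrableOn]
  ring

lemma Q_hasDerivAt (t : ℝ) : HasDerivAt Q (-phi t) t := by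
  have e : Q = fun t => Q 0 - ∫ x in (0:ℝ)..t, phi x := funext Q_eq_sub
  rw [e]
  exact (phi_cont.integral_hasStrictDerivAt 0 t).hasDerivAt.const_sub _

lemma mills (t : ℝ) : t * phi t ≤ (1 + t ^ 2) * Q t := by
  have hd : ∀ x, HasDerivAt (fun x => Q x - x * phi x / (1 + x ^ 2))
      (-(2 * phi x / (1 + x ^ 2) ^ 2)) x := by
    intro x
    have hx : 1 + x ^ 2 ≠ 0 := by positivity
    have h := (Q_hasDerivAt x).sub
      (((hasDerivAt_id x).mul (phi_hasDerivAt x)).div ((hasDerivAt_pow 2 x).const_add 1) hx)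
    refine h.congr_deriv ?_
    simp
    field_simp
    ring
  have hanti : Antitone (fun x => Q x - x * phi x / (1 + x ^ 2)) := by
    apply antitone_of_hasDerivAt_nonpos hd
    intro x
    have := phi_pos x
    simp only [Pi.zero_apply, Left.neg_nonpos_iff]
    positivity
  have hlow : ∀ s, 0 < s → -(phi 0 * s⁻¹) ≤ Q s - s * phi s / (1 + s ^ 2) := by
    intro s hs
    have h1 := Q_pos s
    have h2 : phi s ≤ phi 0 := by
      rw [phi_eq, phi_eq]
      gcongr
    have h3 : s * phi s / (1 + s ^ 2) ≤ phi 0 * s⁻¹ := by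
      rw [← div_eq_mul_inv, div_le_div_iff₀ (by positivity) hs]
      have := phi_pos 0
      nlinarith [mul_le_mul_of_nonneg_left h2 (sq_nonneg s)]
    linarith
  have hlim : Filter.Tendsto (fun s : ℝ => -(phi 0 * s⁻¹)) Filter.atTop (nhds 0) := by
    simpa using (tendsto_inv_atTop_zero.const_mul (phi 0)).neg
  have h0 : 0 ≤ Q t - t * phi t / (1 + t ^ 2) := by
    apply le_of_tendsto hlim
    filter_upwards [Filter.eventually_ge_atTop t, Filter.eventually_gt_atTop 0] with s h1 h2
    exact (hlow s h2).trans (hanti h1)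
  have h1 : t * phi t / (1 + t ^ 2) ≤ Q t := by linarith
  rw [div_le_iff₀ (by positivity)] at h1
  linarith

lemma hazard {t : ℝ} (ht : 0 ≤ t) : 0 ≤ -2 * log (Q t) - t * phi t / Q t := by
  have hd : ∀ x, HasDerivAt (fun x => -2 * log (Q x) - x * phi x / Q x)
      (phi x / Q x ^ 2 * ((1 + x ^ 2) * Q x - x * phi x)) x := by
    intro x
    have hx := (Q_pos x).ne'
    have h := (((Q_hasDerivAt x).log hx).const_mul (-2)).sub
      (((hasDerivAt_id x).mul (phi_hasDerivAt x)).div (Q_hasDerivAt x) hx)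
    refine h.congr_deriv ?_
    simp
    field_simp
    ring
  have hm : Monotone (fun x => -2 * log (Q x) - x * phi x / Q x) := by
    apply monotone_of_hasDerivAt_nonneg hd
    intro x
    have h1 := phi_pos x
    have h2 := Q_pos x
    have h3 := mills x
    exact mul_nonneg (by positivity) (by linarith)
  have h := hm ht
  have h0 : log (Q 0) ≤ 0 := log_nonpos (Q_pos 0).le (Q_le_one 0)
  simp only [zero_mul, zero_div] at h
  linarith

lemma log_mono : MonotoneOn (fun x => log (Q x) / x ^ 2) (Set.Ioi 0) := by
  have hd : ∀ x ∈ Set.Ioi (0:ℝ), HasDerivAt (fun x => log (Q x) / x ^ 2)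
      ((-2 * log (Q x) - x * phi x / Q x) / x ^ 3) x := by
    intro x hx
    have hx0 : x ≠ 0 := ne_of_gt hx
    have hq := (Q_pos x).ne'
    have h := ((Q_hasDerivAt x).log hq).div (hasDerivAt_pow 2 x) (pow_ne_zero 2 hx0)
    refine h.congr_deriv ?_
    simp
    field_simp
    ring
  apply monotoneOn_of_hasDerivWithinAt_nonneg (convex_Ioi 0)
    (fun x hx => (hd x hx).continuousAt.continuousWithinAt)
    (f' := fun x => (-2 * log (Q x) - x * phi x / Q x) / x ^ 3)
  · intro x hx
    rw [interior_Ioi] at hx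
    exact (hd x hx).hasDerivWithinAt
  · intro x hx
    rw [interior_Ioi] at hx
    have hx' : 0 < x := hx
    exact div_nonneg (hazard hx'.le) (by positivity)

theorem Q_delta_bounds (t δ : ℝ) (ht : 0 ≤ t) (hδ0 : 0 ≤ δ) (hδ1 : δ ≤ 1) :
    Q t ≤ Q (δ * t) ∧ Q (δ * t) ≤ Q t ^ (δ ^ 2) := by
  have hle : δ * t ≤ t := mul_le_of_le_one_left ht hδ1
  refine ⟨Q_anti hle, ?_⟩
  rcases hδ0.eq_or_lt with rfl | hδ
  · simpa using Q_le_one 0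
  rcases ht.eq_or_lt with rfl | ht
  · rw [mul_zero]
    have h := rpow_le_rpow_of_exponent_ge (Q_pos 0) (Q_le_one 0)
      (show δ ^ 2 ≤ 1 by nlinarith)
    simpa using h
  · have h := log_mono (show δ * t ∈ Set.Ioi 0 from mul_pos hδ ht) ht hle
    simp only at h
    rw [div_le_div_iff₀ (by positivity) (by positivity)] at h
    have h2 : log (Q (δ * t)) ≤ δ ^ 2 * log (Q t) := by
      have ht2 : 0 < t ^ 2 := by positivity
      apply le_of_mul_le_mul_right _ ht2
      nlinarith
    rw [← log_le_log_iff (Q_pos _) (rpow_pos_of_pos (Q_pos t) _), log_rpow (Q_pos t)]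
    exact h2
end

section
/- (Impossibility of non-interactive correlated randomness generation.) Let ε ∈ (0, 1/2], ε' ∈ (0, 1/2), α ∈ (0, 1], and let n, k ≥ 1 be integers with h(ε') ≤ 4·ε·(1−ε)·α. Let (X,Y) ∼ DSBS(1−2ε)^⊗n, and let f, g : {0,1}^n → {0,1}^k be functions such that P(f(X) = z) ≤ 2^{−α·k} for every z ∈ {0,1}^k (i.e. f(X) has min-entropy at least α·k bits). Then P(Δ(f(X), g(Y)) ≤ ε'·k) ≤ 2^{−ν·k}, where ν = α·(√(1 − h(ε')/α) − (1−2ε))² / (4·ε·(1−ε)). -/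
open MeasureTheory ProbabilityTheory Real

/-- The distribution of a single coordinate pair of the doubly symmetric binary source
`DSBS(1-2ε)`: a uniform bit together with its ε-noisy copy. -/
noncomputable def dsbsPair (ε : ℝ) : Measure (Bool × Bool) :=
  ENNReal.ofReal ((1 - ε) / 2) • Measure.dirac (false, false) +
  ENNReal.ofReal ((1 - ε) / 2) • Measure.dirac (true, true) +
  ENNReal.ofReal (ε / 2) • Measure.dirac (false, true) +
  ENNReal.ofReal (ε / 2) • Measure.dirac (true, false)

/-- The distribution `DSBS(1-2ε)^⊗n` on pairs of `n`-bit strings. -/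
noncomputable def dsbs (ε : ℝ) (n : ℕ) : Measure ((Fin n → Bool) × (Fin n → Bool)) :=
  (Measure.pi fun _ : Fin n => dsbsPair ε).map
    (fun f => (fun i => (f i).1, fun i => (f i).2))

/-- The binary entropy function (base 2). -/
noncomputable def binH (p : ℝ) : ℝ := -(p * Real.logb 2 p) - (1 - p) * Real.logb 2 (1 - p)


lemma rchoose_succ (a : ℝ) (n : ℕ) :
    Ring.choose a (n + 1) = Ring.choose a n * (a - n) / (n + 1) := by
  have h1 := Ring.descPochhammer_eq_factorial_smul_choose a (n + 1)
  have h2 := Ring.descPochhammer_eq_factorial_smul_choose a n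
  rw [descPochhammer_succ_right, Polynomial.smeval_mul, h2] at h1
  simp only [Polynomial.smeval_sub, Polynomial.smeval_X, Polynomial.smeval_natCast,
    nsmul_eq_mul, Nat.factorial_succ] at h1
  push_cast at h1
  have h3 : ((n.factorial : ℕ) : ℝ) ≠ 0 := by positivity
  have h4 : ((n : ℝ) + 1) ≠ 0 := by positivity
  rw [eq_div_iff h4]
  apply mul_left_cancel₀ h3
  simp at h1
  linarith

lemma rchoose_even_le {p r l : ℝ} (hp : 1 < p) (hpr : p ≤ r) (hr : r ≤ 2)
    (hl : l ^ 2 * (r - 1) = p - 1) (m : ℕ) :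
    0 ≤ Ring.choose r (2 * m + 2) ∧ 
    Ring.choose r (2 * m + 2) * (l ^ 2) ^ (m + 1) ≤ r / p * Ring.choose p (2 * m + 2) := by
  have hl0 : 0 ≤ l ^ 2 := sq_nonneg l
  have hl1 : l ^ 2 ≤ 1 := by
    by_contra h
    push Not at h
    nlinarith
  induction m with
  | zero =>
    have e : ∀ a : ℝ, Ring.choose a 2 = a * (a - 1) / 2 := by
      intro a
      rw [rchoose_succ, rchoose_succ]; simp; ring
    simp only [mul_zero, zero_add, e, pow_one]
    constructor
    · have : 0 ≤ r - 1 := by linarith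
      have : 0 ≤ r := by linarith
      positivity
    · apply le_of_eq
      have : p ≠ 0 := by linarith
      rw [← hl]
      field_simp
  | succ m ih =>
    obtain ⟨ih0, ih1⟩ := ih
    have e : ∀ a : ℝ, Ring.choose a (2 * (m + 1) + 2) = Ring.choose a (2 * m + 2) *
        (((2 * m + 2 - a) * (2 * m + 3 - a)) / ((2 * m + 3) * (2 * m + 4))) := by
      intro a
      rw [show 2 * (m + 1) + 2 = (2 * m + 2 + 1) + 1 by ring, rchoose_succ, rchoose_succ]
      push_cast
      field_simp
      ring
    have hm : (0 : ℝ) ≤ m := by positivity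
    have a1 : 0 ≤ 2 * m + 2 - r := by linarith
    have a2 : 0 ≤ 2 * m + 3 - r := by linarith
    have a3 : 0 ≤ 2 * m + 2 - p := by linarith
    have a4 : 0 ≤ 2 * m + 3 - p := by linarith
    rw [e, e]
    constructor
    · positivity
    · rw [pow_succ (l ^ 2) (m + 1)]
      have : ((2 * m + 2 - r) * (2 * m + 3 - r)) / ((2 * m + 3) * (2 * m + 4)) * l ^ 2 ≤ 
         ((2 * m + 2 - p) * (2 * m + 3 - p)) / ((2 * m + 3) * (2 * m + 4)) := by
        calc _ ≤ ((2 * m + 2 - r) * (2 * m + 3 - r)) / ((2 * m + 3) * (2 * m + 4)) * 1 := by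
              gcongr
          _ ≤ _ := by
              rw [mul_one]; gcongr
      calc _ = (Ring.choose r (2 * m + 2) * (l ^ 2) ^ (m + 1)) * 
          (((2 * m + 2 - r) * (2 * m + 3 - r)) / ((2 * m + 3) * (2 * m + 4)) * l ^ 2) := by ring
        _ ≤ (r / p * Ring.choose p (2 * m + 2)) * 
          (((2 * m + 2 - p) * (2 * m + 3 - p)) / ((2 * m + 3) * (2 * m + 4))) := by
            apply mul_le_mul ih1 this (by positivity)
            exact le_trans (by positivity) ih1
        _ = _ := by ring

noncomputable def avgp (p x : ℝ) : ℝ := ((1 + x) ^ p + (1 - x) ^ p) / 2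

lemma hasSum_rpow (a : ℝ) {x : ℝ} (hx : |x| < 1) :
    HasSum (fun n : ℕ => Ring.choose a n * x ^ n) ((1 + x) ^ a) := by
  have := (Real.one_add_rpow_hasFPowerSeriesOnBall_zero (a := a)).hasSum (y := x) (by
    simp [← ofReal_norm]
    exact hx)
  simpa [binomialSeries, FormalMultilinearSeries.coeff_ofScalars, mul_comm] using this

lemma hasSum_avgp (a : ℝ) {x : ℝ} (hx : |x| < 1) :
    HasSum (fun n : ℕ => Ring.choose a n * ((x ^ n + (-x) ^ n) / 2)) (avgp a x) := by
  have h1 := hasSum_rpow a hx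
  have h2 := hasSum_rpow a (x := -x) (by simpa using hx)
  have := (h1.add h2).div_const 2
  convert! this using 1
  funext n; ring

lemma avgp_nonneg (p : ℝ) {x : ℝ} (hx : |x| ≤ 1) : 0 ≤ avgp p x := by
  rw [abs_le] at hx
  have h1 : 0 ≤ 1 + x := by linarith
  have h2 : 0 ≤ 1 - x := by linarith
  unfold avgp; positivity

lemma bonami_lt {p r l x : ℝ} (hp : 1 < p) (hpr : p ≤ r) (hr : r ≤ 2)
    (hl : l ^ 2 * (r - 1) = p - 1) (hx : |x| < 1) :
    avgp r (l * x) ≤ avgp p x ^ (r / p) := by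
  have hl1 : l ^ 2 ≤ 1 := by
    by_contra h
    push Not at h
    nlinarith
  have hl2 : |l| ≤ 1 := by
    rw [← sq_le_one_iff_abs_le_one]; exact hl1
  have hlx : |l * x| < 1 := by
    rw [abs_mul]
    exact lt_of_le_of_lt (mul_le_of_le_one_left (abs_nonneg x) hl2) hx
  have s1 := hasSum_avgp r hlx
  have s2 := ((hasSum_avgp p hx).mul_left (r / p)).add (hasSum_ite_eq 0 (1 - r / p))
  have key := hasSum_le ?_ s1 s2
  · have b := one_add_mul_self_le_rpow_one_add (s := avgp p x - 1) 
      (by linarith [avgp_nonneg p hx.le]) (p := r / p) (by rw [one_le_div]; exact hpr; linarith)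
    rw [add_sub_cancel] at b
    linarith
  · intro n
    rcases Nat.even_or_odd n with he | ho
    · obtain ⟨m, rfl⟩ := he.two_dvd
      rcases m with _ | m
      · simp
      · simp only [pow_mul, neg_sq, mul_pow]
        have := (rchoose_even_le hp hpr hr hl m).2
        have hx0 : 0 ≤ (x ^ 2) ^ (m + 1) := by positivity
        have := mul_le_mul_of_nonneg_right this hx0
        rw [if_neg (by omega), show 2 * (m + 1) = 2 * m + 2 by ring]
        linarith
    · simp [ho.neg_pow, (show n ≠ 0 by rintro rfl; simp at ho)]

lemma bonami {p r l x : ℝ} (hp : 1 < p) (hpr : p ≤ r) (hr : r ≤ 2)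
    (hl : l ^ 2 * (r - 1) = p - 1) (hx : |x| ≤ 1) :
    avgp r (l * x) ^ (1 / r) ≤ avgp p x ^ (1 / p) := by
  have h : avgp r (l * x) ≤ avgp p x ^ (r / p) := by
    have c : ∀ a : ℝ, 0 ≤ a → Continuous (avgp a) := by
      intro a ha
      unfold avgp
      exact ((((continuous_const.add continuous_id).rpow_const (fun _ => Or.inr ha))).add
        ((continuous_const.sub continuous_id).rpow_const (fun _ => Or.inr ha))).div_const 2
    have hxc : x ∈ closure (Set.Ioo (-1 : ℝ) 1) := by
      rw [closure_Ioo (by norm_num)]; exact abs_le.1 hx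
    refine ContinuousWithinAt.closure_le (f := fun x => avgp r (l * x)) 
      (g := fun x => avgp p x ^ (r / p)) hxc ?_ ?_ ?_
    · exact ((c r (by linarith)).comp (continuous_const.mul continuous_id)).continuousWithinAt
    · exact ((c p (by linarith)).rpow_const 
        (fun _ => Or.inr (div_nonneg (by linarith) (by linarith)))).continuousWithinAt
    · intro y hy
      exact bonami_lt hp hpr hr hl (abs_lt.2 hy)
  have hl1 : l ^ 2 ≤ 1 := by
    by_contra h
    push Not at h
    nlinarith
  have hl2 : |l| ≤ 1 := by
    rw [← sq_le_one_iff_abs_le_one]; exact hl1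
  have hlx : |l * x| ≤ 1 := by
    rw [abs_mul]
    exact le_trans (mul_le_of_le_one_left (abs_nonneg x) hl2) hx
  have hr0 : 0 < r := by linarith
  calc _ ≤ (avgp p x ^ (r / p)) ^ (1 / r) := 
        Real.rpow_le_rpow (avgp_nonneg _ hlx) h (by positivity)
    _ = _ := by
      rw [← Real.rpow_mul (avgp_nonneg _ hx)]
      congr 1
      field_simp

/-- normalized two-point inequality -/
lemma two_point_norm {p q ρ x y : ℝ} (hρ : 0 < ρ) (hρ1 : ρ < 1) (hp : 1 < p) (hq : 1 < q)
    (hq2 : q ≤ 2) (h : (p - 1) * (q - 1) = ρ ^ 2) (hx : |x| ≤ 1) (hy : |y| ≤ 1) :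
    1 + ρ * x * y ≤ avgp p x ^ (1 / p) * avgp q y ^ (1 / q) := by
  rcases le_total p 2 with hp2 | hp2
  · have e : ∀ a z : ℝ, 1 < a → a ≤ 2 → |z| ≤ 1 → √(1 + (a - 1) * z ^ 2) ≤ avgp a z ^ (1 / a) := by
      intro a z ha ha2 hz
      have := bonami (p := a) (r := 2) (l := √(a - 1)) ha ha2 le_rfl 
        (by rw [Real.sq_sqrt (by linarith)]; ring) hz
      have e2 : avgp 2 (√(a - 1) * z) = 1 + (a - 1) * z ^ 2 := by
        unfold avgp
        have : √(a - 1) ^ 2 = a - 1 := Real.sq_sqrt (by linarith)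
        simp only [Real.rpow_ofNat]
        linear_combination z ^ 2 * this
      rw [e2, ← Real.sqrt_eq_rpow] at this
      exact this
    refine le_trans ?_ (mul_le_mul (e p x hp hp2 hx) (e q y hq hq2 hy) (Real.sqrt_nonneg _)
      (Real.rpow_nonneg (avgp_nonneg _ hx) _))
    have hp1 : 0 ≤ p - 1 := by linarith
    have hq1 : 0 ≤ q - 1 := by linarith
    rw [← Real.sqrt_mul (by positivity)]
    apply Real.le_sqrt_of_sq_le
    have h3 : √(p - 1) * √(q - 1) = ρ := by
      rw [← Real.sqrt_mul hp1, h, Real.sqrt_sq hρ.le]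
    have h1 := Real.sq_sqrt hp1
    have h2 := Real.sq_sqrt hq1
    have : 0 ≤ (√(p - 1) * x - √(q - 1) * y) ^ 2 := sq_nonneg _
    have h4 : (√(p - 1) * x - √(q - 1) * y) ^ 2 = (p-1) * x ^ 2 + (q-1) * y ^2 - 2 * ρ * x * y := by
      rw [← h3]
      nth_rewrite 2 [← h1]
      nth_rewrite 2 [← h2]
      ring
    have h5 : (1 + (p - 1) * x ^ 2) * (1 + (q - 1) * y ^ 2) = 
      1 + (p-1) * x ^ 2 + (q-1) * y ^2 + ρ ^ 2 * x ^ 2 * y ^ 2 := by rw [← h]; ring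
    rw [h5]
    linarith
  · have hc : p.HolderConjugate (p / (p - 1)) := Real.HolderConjugate.conjExponent hp
    set r := p / (p - 1) with hrdef
    have hp1 : 0 < p - 1 := by linarith
    have hr1 : r - 1 = 1 / (p - 1) := by rw [hrdef]; field_simp; ring
    have hr2 : r ≤ 2 := by rw [hrdef, div_le_iff₀ hp1]; linarith
    have hqr : q ≤ r := by
      have : q - 1 ≤ r - 1 := by
        rw [hr1, le_div_iff₀ hp1]
        nlinarith
      linarith
    have hb := bonami (p := q) (r := r) (l := ρ) hq hqr hr2 (by rw [hr1, ← h]; field_simp) hy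
    refine le_trans ?_ (mul_le_mul_of_nonneg_left hb (Real.rpow_nonneg (avgp_nonneg _ hx) _))
    have hry : |ρ * y| ≤ 1 := by
      rw [abs_mul, abs_of_pos hρ]
      exact le_trans (mul_le_of_le_one_left (abs_nonneg y) hρ1.le) hy
    have H := Real.inner_le_Lp_mul_Lq (Finset.univ : Finset (Fin 2)) ![1 + x, 1 - x] 
      ![1 + ρ * y, 1 - ρ * y] hc
    have hx' := abs_le.1 hx
    have hry' := abs_le.1 hry
    simp only [Fin.sum_univ_two, Matrix.cons_val_zero, Matrix.cons_val_one] at H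
    rw [abs_of_nonneg (by linarith), abs_of_nonneg (by linarith), abs_of_nonneg (by linarith),
      abs_of_nonneg (by linarith)] at H
    have e : ∀ a z : ℝ, |z| ≤ 1 → ((1 + z) ^ a + (1 - z) ^ a) ^ (1 / a) = 
        2 ^ (1 / a) * avgp a z ^ (1 / a) := by
      intro a z hz
      rw [← Real.mul_rpow (by norm_num) (avgp_nonneg _ hz)]
      congr 1
      unfold avgp; ring
    rw [e _ _ hx, e _ _ hry] at H
    have e3 : (2:ℝ) ^ (1 / p) * 2 ^ (1 / r) = 2 := by
      rw [← Real.rpow_add (by norm_num)]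
      have := hc.inv_add_inv_eq_one
      simp only [one_div, this, Real.rpow_one]
    have e4 : 2 ^ (1 / p) * avgp p x ^ (1 / p) * (2 ^ (1 / r) * avgp r (ρ * y) ^ (1 / r)) = 
      2 * (avgp p x ^ (1 / p) * avgp r (ρ * y) ^ (1 / r)) := by
      linear_combination (avgp p x ^ (1 / p) * avgp r (ρ * y) ^ (1 / r)) * e3
    rw [e4] at H
    linarith

noncomputable def wt (ε : ℝ) (a b : Bool) : ℝ := if a = b then (1 - ε) / 2 else ε / 2

noncomputable def kern (ε : ℝ) (n : ℕ) (x y : Fin n → Bool) : ℝ := ∏ i, wt ε (x i) (y i)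

lemma avgp_scale {p A x : ℝ} (hp : 0 < p) (hA : 0 ≤ A) (hx : |x| ≤ 1) :
    (1 / 2 * (A * (1 + x)) ^ p + 1 / 2 * (A * (1 - x)) ^ p) ^ (1 / p) =
      A * avgp p x ^ (1 / p) := by
  have hx' := abs_le.1 hx
  rw [Real.mul_rpow hA (by linarith), Real.mul_rpow hA (by linarith)]
  have : 1 / 2 * (A ^ p * (1 + x) ^ p) + 1 / 2 * (A ^ p * (1 - x) ^ p) = A ^ p * avgp p x := by
    unfold avgp; ring
  rw [this, Real.mul_rpow (Real.rpow_nonneg hA _) (avgp_nonneg _ hx), ← Real.rpow_mul hA,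
    mul_one_div_cancel hp.ne', Real.rpow_one]

lemma exists_scale {a b : ℝ} (ha : 0 ≤ a) (hb : 0 ≤ b) :
    ∃ A x : ℝ, 0 ≤ A ∧ |x| ≤ 1 ∧ a = A * (1 + x) ∧ b = A * (1 - x) := by
  rcases eq_or_lt_of_le (add_nonneg ha hb) with h | h
  · refine ⟨0, 0, le_rfl, by simp, ?_, ?_⟩ <;> linarith
  · refine ⟨(a + b) / 2, (a - b) / (a + b), by positivity, ?_, ?_, ?_⟩
    · rw [abs_le, le_div_iff₀ h, div_le_iff₀ h]
      constructor <;> linarith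
    · field_simp; ring
    · field_simp; ring

/-- admissible exponents -/
def Adm (ε p q : ℝ) : Prop :=
  (ε = 1 / 2 ∧ p = 1 ∧ q = 1) ∨ 
  (0 < ε ∧ ε < 1 / 2 ∧ 1 < p ∧ 1 < q ∧ q ≤ 2 ∧ (p - 1) * (q - 1) = (1 - 2 * ε) ^ 2)

lemma Adm.pos {ε p q : ℝ} (h : Adm ε p q) : 0 < p ∧ 0 < q ∧ 0 < ε ∧ ε ≤ 1 / 2 := by
  rcases h with ⟨rfl, rfl, rfl⟩ | ⟨h1, h2, h3, h4, h5, h6⟩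
  · norm_num
  · refine ⟨by linarith, by linarith, h1, h2.le⟩

lemma two_point {ε p q : ℝ} (h : Adm ε p q) (F G : Bool → ℝ) (hF : ∀ a, 0 ≤ F a)
    (hG : ∀ a, 0 ≤ G a) :
    ∑ a, ∑ b, wt ε a b * (F a * G b) ≤ 
      (∑ a, 1 / 2 * F a ^ p) ^ (1 / p) * (∑ b, 1 / 2 * G b ^ q) ^ (1 / q) := by
  obtain ⟨A, x, hA, hx, e1, e2⟩ := exists_scale (hF true) (hF false)
  obtain ⟨B, y, hB, hy, e3, e4⟩ := exists_scale (hG true) (hG false)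
  have hpos := h.pos
  simp only [Fintype.sum_bool, wt, e1, e2, e3, e4, avgp_scale hpos.1 hA hx, 
    avgp_scale hpos.2.1 hB hy]
  have hAB : 0 ≤ A * B := mul_nonneg hA hB
  have key : 1 + (1 - 2 * ε) * x * y ≤ avgp p x ^ (1 / p) * avgp q y ^ (1 / q) := by
    rcases h with ⟨rfl, rfl, rfl⟩ | ⟨h1, h2, h3, h4, h5, h6⟩
    · simp [avgp]
    · exact two_point_norm (by linarith) (by linarith) h3 h4 h5 h6 hx hy
  have := mul_le_mul_of_nonneg_left key hAB
  simp
  simp at this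
  linarith

lemma sum_cons {n : ℕ} (φ : (Fin (n + 1) → Bool) → ℝ) :
    ∑ x, φ x = ∑ a : Bool, ∑ x : Fin n → Bool, φ (Fin.cons a x) := by
  rw [← (Fin.consEquiv (fun _ : Fin (n + 1) => Bool)).sum_comp, Fintype.sum_prod_type]
  rfl

lemma wt_nonneg {ε : ℝ} (h0 : 0 < ε) (h1 : ε ≤ 1 / 2) (a b : Bool) : 0 ≤ wt ε a b := by
  unfold wt; split_ifs <;> linarith

lemma hyper {ε p q : ℝ} (h : Adm ε p q) (n : ℕ) (F G : (Fin n → Bool) → ℝ) (hF : ∀ a, 0 ≤ F a)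
    (hG : ∀ a, 0 ≤ G a) :
    ∑ x, ∑ y, kern ε n x y * (F x * G y) ≤ 
      (∑ x, (1 / 2) ^ n * F x ^ p) ^ (1 / p) * (∑ y, (1 / 2) ^ n * G y ^ q) ^ (1 / q) := by
  have hpos := h.pos
  induction n with
  | zero =>
    simp [kern]
    rw [← Real.rpow_mul (hF _), ← Real.rpow_mul (hG _), mul_inv_cancel₀ hpos.1.ne',
      mul_inv_cancel₀ hpos.2.1.ne', Real.rpow_one, Real.rpow_one]
  | succ n ih =>
    simp only [sum_cons]
    have S1 : ∀ a, 0 ≤ ∑ x : Fin n → Bool, (1 / 2 : ℝ) ^ n * F (Fin.cons a x) ^ p := by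
      intro a
      apply Finset.sum_nonneg
      intro x _
      have := Real.rpow_nonneg (hF (Fin.cons a x)) p
      positivity
    have S2 : ∀ a, 0 ≤ ∑ x : Fin n → Bool, (1 / 2 : ℝ) ^ n * G (Fin.cons a x) ^ q := by
      intro a
      apply Finset.sum_nonneg
      intro x _
      have := Real.rpow_nonneg (hG (Fin.cons a x)) q
      positivity
    calc _ = ∑ a, ∑ b, wt ε a b * (∑ x, ∑ y, kern ε n x y * 
          (F (Fin.cons a x) * G (Fin.cons b y))) := by
          apply Finset.sum_congr rfl
          intro a _
          rw [Finset.sum_comm]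
          apply Finset.sum_congr rfl
          intro b _
          rw [Finset.mul_sum]
          apply Finset.sum_congr rfl
          intro x _
          rw [Finset.mul_sum]
          apply Finset.sum_congr rfl
          intro y _
          simp only [kern, Fin.prod_univ_succ, Fin.cons_zero, Fin.cons_succ]
          ring
      _ ≤ ∑ a, ∑ b, wt ε a b * 
          ((∑ x : Fin n → Bool, (1 / 2 : ℝ) ^ n * F (Fin.cons a x) ^ p) ^ (1 / p) * 
          (∑ y : Fin n → Bool, (1 / 2 : ℝ) ^ n * G (Fin.cons b y) ^ q) ^ (1 / q)) := by
          apply Finset.sum_le_sum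
          intro a _
          apply Finset.sum_le_sum
          intro b _
          apply mul_le_mul_of_nonneg_left _ (wt_nonneg hpos.2.2.1 hpos.2.2.2 a b)
          exact ih (fun x => F (Fin.cons a x)) (fun y => G (Fin.cons b y)) (fun _ => hF _) 
            (fun _ => hG _)
      _ ≤ _ := two_point h _ _ (fun a => Real.rpow_nonneg (S1 a) _) 
            (fun a => Real.rpow_nonneg (S2 a) _)
      _ = _ := by
          congr 2
          · apply Finset.sum_congr rfl
            intro a _
            rw [← Real.rpow_mul (S1 a), one_div_mul_cancel hpos.1.ne', Real.rpow_one,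
              Finset.mul_sum]
            apply Finset.sum_congr rfl
            intro x _
            ring
          · apply Finset.sum_congr rfl
            intro a _
            rw [← Real.rpow_mul (S2 a), one_div_mul_cancel hpos.2.1.ne', Real.rpow_one,
              Finset.mul_sum]
            apply Finset.sum_congr rfl
            intro x _
            ring

lemma sum_kern (ε : ℝ) (n : ℕ) (x : Fin n → Bool) : ∑ y, kern ε n x y = (1 / 2) ^ n := by
  have := Finset.prod_univ_sum (fun _ : Fin n => (Finset.univ : Finset Bool)) 
    (fun i b => wt ε (x i) b)
  rw [Fintype.piFinset_univ] at this
  unfold kern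
  rw [← this]
  have e : ∀ a : Bool, ∑ b, wt ε a b = 1 / 2 := by
    intro a
    cases a <;> simp [wt] <;> ring
  simp only [e, Finset.prod_const, Finset.card_univ, Fintype.card_fin]

lemma dsbsPair_singleton {ε : ℝ} (a b : Bool) :
    dsbsPair ε {(a, b)} = ENNReal.ofReal (wt ε a b) := by
  cases a <;> cases b <;> simp [dsbsPair, wt]

instance (ε : ℝ) : IsFiniteMeasure (dsbsPair ε) := by
  unfold dsbsPair
  constructor
  simp [lt_top_iff_ne_top]

lemma dsbs_apply {ε : ℝ} (h0 : 0 < ε) (h1 : ε ≤ 1 / 2) (n : ℕ) (S : Set _) [DecidablePred (· ∈ S)] :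
    (dsbs ε n S).toReal = ∑ x, ∑ y, kern ε n x y * (if (x, y) ∈ S then 1 else 0) := by
  classical
  have hm : Measurable (fun f : Fin n → Bool × Bool => 
    ((fun i => (f i).1, fun i => (f i).2) : (Fin n → Bool) × (Fin n → Bool))) := 
    measurable_of_finite _
  have : IsFiniteMeasure (dsbs ε n) := by unfold dsbs; infer_instance
  have hs : ∀ x y, (dsbs ε n).real {(x, y)} = kern ε n x y := by
    intro x y
    rw [measureReal_def, dsbs, Measure.map_apply hm (measurableSet_singleton _)]
    have : (fun f : Fin n → Bool × Bool => 
      ((fun i => (f i).1, fun i => (f i).2) : (Fin n → Bool) × (Fin n → Bool))) ⁻¹' {(x, y)} = 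
      {fun i => (x i, y i)} := by
      ext f
      simp only [Set.mem_preimage, Set.mem_singleton_iff, funext_iff, Prod.ext_iff]
      exact forall_and.symm
    rw [this, Measure.pi_singleton, ENNReal.toReal_prod]
    simp only [dsbsPair_singleton, kern]
    apply Finset.prod_congr rfl
    intro i _
    exact ENNReal.toReal_ofReal (wt_nonneg h0 h1 _ _)
  have := sum_measureReal_singleton (μ := dsbs ε n) (Finset.univ.filter (· ∈ S))
  rw [← measureReal_def]
  have e : ((Finset.univ.filter (· ∈ S) : Finset _) : Set _) = S := by ext; simp
  rw [e] at this
  rw [← this, Finset.sum_filter, Fintype.sum_prod_type]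
  simp [hs]

lemma ball_card {e : ℝ} (he0 : 0 < e) (he1 : e < 1 / 2) (k : ℕ) (z : Fin k → Bool) :
    ∑ w : Fin k → Bool, (if (hammingDist z w : ℝ) ≤ e * k then (1 : ℝ) else 0) ≤ 
      2 ^ (binH e * k) := by
  have := Finset.prod_univ_sum (fun _ : Fin k => (Finset.univ : Finset Bool)) 
    (fun i b => if z i ≠ b then e else 1 - e)
  rw [Fintype.piFinset_univ] at this
  have e1 : ∀ i, ∑ b, (if z i ≠ b then e else 1 - e) = 1 := by
    intro i
    cases z i <;> simp
  simp only [e1, Finset.prod_const_one] at this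
  have e2 : ∀ w : Fin k → Bool, (∏ i, (if z i ≠ w i then e else 1 - e)) = 
      e ^ (hammingDist z w : ℝ) * (1 - e) ^ ((k : ℝ) - hammingDist z w) := by
    intro w
    have hle : hammingDist z w ≤ k := by simpa using hammingDist_le_card_fintype (x := z) (y := w)
    rw [Finset.prod_ite, Finset.prod_const, Finset.prod_const, ← Nat.cast_sub hle, 
      Real.rpow_natCast, Real.rpow_natCast]
    congr 2
    have := Finset.card_filter_add_card_filter_not (s := (Finset.univ : Finset (Fin k)))
      (fun i => z i ≠ w i)
    simp only [Finset.card_univ, Fintype.card_fin] at this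
    have h2 : hammingDist z w = (Finset.univ.filter (fun i => z i ≠ w i)).card := rfl
    omega
  simp only [e2] at this
  have e3 : (2 : ℝ) ^ (-(binH e * k)) = e ^ (e * k) * (1 - e) ^ ((k : ℝ) - e * k) := by
    have h1e : 0 < 1 - e := by linarith
    have a1 : e = 2 ^ (Real.logb 2 e) := (Real.rpow_logb (by norm_num) (by norm_num) he0).symm
    have a2 : 1 - e = 2 ^ (Real.logb 2 (1 - e)) := 
      (Real.rpow_logb (by norm_num) (by norm_num) h1e).symm
    have b1 : e ^ (e * k) = 2 ^ (Real.logb 2 e * (e * k)) := by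
      rw [Real.rpow_mul (x := 2) (by norm_num), ← a1]
    have b2 : (1 - e) ^ ((k : ℝ) - e * k) = 2 ^ (Real.logb 2 (1 - e) * ((k : ℝ) - e * k)) := by
      rw [Real.rpow_mul (x := 2) (by norm_num), ← a2]
    rw [b1, b2, ← Real.rpow_add (by norm_num)]
    congr 1
    unfold binH; ring
  have e4 : ∀ w : Fin k → Bool, (if (hammingDist z w : ℝ) ≤ e * k then (1 : ℝ) else 0) * 
      2 ^ (-(binH e * k)) ≤ e ^ (hammingDist z w : ℝ) * (1 - e) ^ ((k : ℝ) - hammingDist z w) := by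
    intro w
    have h1e : 0 < 1 - e := by linarith
    split_ifs with hw
    · rw [one_mul, e3]
      set d : ℝ := ((hammingDist z w : ℕ) : ℝ)
      have c1 : e ^ (e * k) = e ^ d * e ^ (e * k - d) := by
        rw [← Real.rpow_add he0]; congr 1; ring
      have c2 : (1 - e) ^ ((k : ℝ) - d) = (1 - e) ^ ((k : ℝ) - e * k) * (1 - e) ^ (e * k - d) := by
        rw [← Real.rpow_add h1e]; congr 1; ring
      rw [c1, c2]
      have c3 : e ^ (e * k - d) ≤ (1 - e) ^ (e * k - d) := 
        Real.rpow_le_rpow he0.le (by linarith) (by linarith)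
      calc _ = e ^ d * (1 - e) ^ ((k : ℝ) - e * k) * e ^ (e * k - d) := by ring
        _ ≤ e ^ d * (1 - e) ^ ((k : ℝ) - e * k) * (1 - e) ^ (e * k - d) := by gcongr
        _ = _ := by ring
    · rw [zero_mul]; positivity
  have e5 := Finset.sum_le_sum (fun w (_ : w ∈ Finset.univ) => e4 w)
  rw [← this, ← Finset.sum_mul, Real.rpow_neg (by norm_num), ← div_eq_mul_inv,
    div_le_one (by positivity)] at e5
  exact e5

lemma holder_sum {ι : Type*} [Fintype ι] (c d : ι → ℝ) {M C p q : ℝ} (hc : ∀ z, 0 ≤ c z)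
    (hd : ∀ z, 0 ≤ d z) (hM : ∀ z, c z ≤ M) (hC0 : 0 < C) (hC : ∑ z, c z ≤ C) (hD : ∑ z, d z ≤ 1)
    (hM0 : 0 ≤ M)
    (hq : 1 ≤ q) (hpq : 0 ≤ 1 / p + 1 / q - 1) :
    ∑ z, c z ^ (1 / p) * d z ^ (1 / q) ≤ M ^ (1 / p + 1 / q - 1) * C ^ (1 - 1 / q) := by
  have hq1 : 0 ≤ 1 - 1 / q := by
    have : 1 / q ≤ 1 := by rw [div_le_one (by linarith)]; exact hq
    linarith
  have hq2 : 0 ≤ 1 / q := by positivity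
  have t : ∀ z, c z ^ (1 / p) * d z ^ (1 / q) ≤ 
      M ^ (1 / p + 1 / q - 1) * C ^ (1 - 1 / q) * ((1 - 1 / q) * (c z / C) + 1 / q * d z) := by
    intro z
    have g := Real.geom_mean_le_arith_mean2_weighted hq1 hq2 (div_nonneg (hc z) hC0.le) (hd z) 
      (by ring)
    have s : c z ^ (1 / p) = c z ^ (1 / p + 1 / q - 1) * c z ^ (1 - 1 / q) := by
      rw [← Real.rpow_add_of_nonneg (hc z) hpq hq1]; congr 1; ring
    have s2 : c z ^ (1 - 1 / q) = C ^ (1 - 1 / q) * (c z / C) ^ (1 - 1 / q) := by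
      rw [← Real.mul_rpow hC0.le (div_nonneg (hc z) hC0.le), mul_div_cancel₀ _ hC0.ne']
    have s3 : c z ^ (1 / p + 1 / q - 1) ≤ M ^ (1 / p + 1 / q - 1) := 
      Real.rpow_le_rpow (hc z) (hM z) hpq
    have n1 : 0 ≤ (c z / C) ^ (1 - 1 / q) := Real.rpow_nonneg (div_nonneg (hc z) hC0.le) _
    have n2 : 0 ≤ d z ^ (1 / q) := Real.rpow_nonneg (hd z) _
    have n3 : 0 ≤ M ^ (1 / p + 1 / q - 1) := Real.rpow_nonneg hM0 _
    calc _ = c z ^ (1 / p + 1 / q - 1) * (C ^ (1 - 1 / q) * ((c z / C) ^ (1 - 1 / q) * 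
          d z ^ (1 / q))) := by rw [s, s2]; ring
      _ ≤ M ^ (1 / p + 1 / q - 1) * (C ^ (1 - 1 / q) * ((1 - 1 / q) * (c z / C) + 1 / q * d z)) := by
          gcongr
      _ = _ := by ring
  refine (Finset.sum_le_sum (fun z _ => t z)).trans ?_
  rw [← Finset.mul_sum]
  apply mul_le_of_le_one_right
  · have n3 : 0 ≤ M ^ (1 / p + 1 / q - 1) := Real.rpow_nonneg hM0 _
    positivity
  · rw [Finset.sum_add_distrib, ← Finset.mul_sum, ← Finset.mul_sum, ← Finset.sum_div]
    have : (∑ z, c z) / C ≤ 1 := by rw [div_le_one hC0]; exact hC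
    nlinarith

lemma binH_nonneg {e : ℝ} (he0 : 0 < e) (he1 : e < 1 / 2) : 0 ≤ binH e := by
  have h1 : Real.logb 2 e ≤ 0 := 
    Real.logb_nonpos (by norm_num) he0.le (by linarith)
  have h2 : Real.logb 2 (1 - e) ≤ 0 := 
    Real.logb_nonpos (by norm_num) (by linarith) (by linarith)
  unfold binH
  nlinarith

lemma sum_sum_kern (ε : ℝ) (n : ℕ) : ∑ x, ∑ y, kern ε n x y = 1 := by
  simp [sum_kern]

lemma kern_nonneg {ε : ℝ} (h0 : 0 < ε) (h1 : ε ≤ 1 / 2) (n : ℕ) (x y : Fin n → Bool) :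
    0 ≤ kern ε n x y := Finset.prod_nonneg (fun _ _ => wt_nonneg h0 h1 _ _)

lemma main_bound {ε p q e α : ℝ} (h : Adm ε p q) (he0 : 0 < e) (he1 : e < 1 / 2) (n k : ℕ)
    (hq : 1 ≤ q) (hpq : 0 ≤ 1 / p + 1 / q - 1)
    (f g : (Fin n → Bool) → (Fin k → Bool))
    (hf : ∀ z : Fin k → Bool, ((dsbs ε n) {p | f p.1 = z}).toReal ≤ 2 ^ (-(α * k))) :
    ((dsbs ε n) {p | (hammingDist (f p.1) (g p.2) : ℝ) ≤ e * k}).toReal ≤ 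
      ((2 : ℝ) ^ (-(α * k)) * 2 ^ (binH e * k)) ^ (1 / p + 1 / q - 1) * 
        (2 ^ (binH e * k)) ^ (1 - 1 / q) := by
  obtain ⟨hp0, hq0, hε0, hε1⟩ := h.pos
  have hf' : ∀ z, ∑ x, (1 / 2 : ℝ) ^ n * (if f x = z then 1 else 0) ≤ 2 ^ (-(α * k)) := by
    intro z
    refine le_trans (le_of_eq ?_) (hf z)
    rw [dsbs_apply hε0 hε1]
    apply Finset.sum_congr rfl
    intro x _
    rw [← sum_kern ε n x, Finset.sum_mul]
    rfl
  rw [dsbs_apply hε0 hε1]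
  let A : (Fin k → Bool) → (Fin n → Bool) → ℝ := fun z x => 
    if (hammingDist (f x) z : ℝ) ≤ e * k then 1 else 0
  let B : (Fin k → Bool) → (Fin n → Bool) → ℝ := fun z y => if g y = z then 1 else 0
  have hA : ∀ z x, 0 ≤ A z x := by intro z x; dsimp [A]; split_ifs <;> norm_num
  have hB : ∀ z x, 0 ≤ B z x := by intro z x; dsimp [B]; split_ifs <;> norm_num
  have hAp : ∀ z x, A z x ^ p = A z x := by
    intro z x; dsimp [A]; split_ifs
    · exact Real.one_rpow _
    · exact Real.zero_rpow hp0.ne'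
  have hBq : ∀ z x, B z x ^ q = B z x := by
    intro z x; dsimp [B]; split_ifs
    · exact Real.one_rpow _
    · exact Real.zero_rpow hq0.ne'
  calc _ = ∑ z, ∑ x, ∑ y, kern ε n x y * (A z x * B z y) := by
        symm
        rw [Finset.sum_comm]
        apply Finset.sum_congr rfl
        intro x _
        rw [Finset.sum_comm]
        apply Finset.sum_congr rfl
        intro y _
        rw [← Finset.mul_sum]
        congr 1
        simp [A, B]
    _ ≤ ∑ z, (∑ x, (1 / 2 : ℝ) ^ n * A z x) ^ (1 / p) * 
          (∑ y, (1 / 2 : ℝ) ^ n * B z y) ^ (1 / q) := by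
        apply Finset.sum_le_sum
        intro z _
        have := hyper h n (A z) (B z) (hA z) (hB z)
        simpa only [hAp, hBq] using this
    _ ≤ _ := by
        apply holder_sum
        · intro z
          exact Finset.sum_nonneg (fun x _ => mul_nonneg (by positivity) (hA z x))
        · intro z
          exact Finset.sum_nonneg (fun x _ => mul_nonneg (by positivity) (hB z x))
        · intro z
          have e1 : ∀ x, A z x = ∑ w, (if (hammingDist z w : ℝ) ≤ e * k then (1 : ℝ) else 0) * 
              (if f x = w then 1 else 0) := by
            intro x
            simp [A, hammingDist_comm z]
          calc _ = ∑ w, (if (hammingDist z w : ℝ) ≤ e * k then (1 : ℝ) else 0) * 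
                ∑ x, (1 / 2 : ℝ) ^ n * (if f x = w then 1 else 0) := by
                simp only [e1, Finset.mul_sum]
                rw [Finset.sum_comm]
                apply Finset.sum_congr rfl
                intro w _
                apply Finset.sum_congr rfl
                intro x _
                ring
            _ ≤ ∑ w, (if (hammingDist z w : ℝ) ≤ e * k then (1 : ℝ) else 0) * 
                2 ^ (-(α * k)) := by
                apply Finset.sum_le_sum
                intro w _
                apply mul_le_mul_of_nonneg_left (hf' w)
                split_ifs <;> norm_num
            _ ≤ 2 ^ (binH e * k) * 2 ^ (-(α * k)) := by
                rw [← Finset.sum_mul]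
                apply mul_le_mul_of_nonneg_right (ball_card he0 he1 k z) (by positivity)
            _ = _ := mul_comm _ _
        · positivity
        · rw [Finset.sum_comm]
          calc _ = ∑ x : Fin n → Bool, (1 / 2 : ℝ) ^ n * ∑ z, A z x := by
                simp only [Finset.mul_sum]
            _ ≤ ∑ x : Fin n → Bool, (1 / 2 : ℝ) ^ n * 2 ^ (binH e * k) := by
                apply Finset.sum_le_sum
                intro x _
                apply mul_le_mul_of_nonneg_left (ball_card he0 he1 k (f x)) (by positivity)
            _ = _ := by simp
        · rw [Finset.sum_comm]
          apply le_of_eq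
          simp only [← Finset.mul_sum]
          simp [B]
        · positivity
        · exact hq
        · exact hpq

theorem non_interactive_correlated_randomness_impossibility
    (ε ε' α : ℝ) (hε0 : 0 < ε) (hε1 : ε ≤ 1 / 2)
    (hε'0 : 0 < ε') (hε'1 : ε' < 1 / 2) (hα0 : 0 < α) (hα1 : α ≤ 1)
    (n k : ℕ) (hn : 1 ≤ n) (hk : 1 ≤ k)
    (hh : binH ε' ≤ 4 * ε * (1 - ε) * α)
    (f g : (Fin n → Bool) → (Fin k → Bool))
    (hf : ∀ z : Fin k → Bool, ((dsbs ε n) {p | f p.1 = z}).toReal ≤ 2 ^ (-(α * k))) :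
    ((dsbs ε n) {p | (hammingDist (f p.1) (g p.2) : ℝ) ≤ ε' * k}).toReal ≤
      2 ^ (-(α * (Real.sqrt (1 - binH ε' / α) - (1 - 2 * ε)) ^ 2 /
        (4 * ε * (1 - ε)) * k)) := by
  have hb0 := binH_nonneg hε'0 hε'1
  have hβ : binH ε' / α ≤ 1 - (1 - 2 * ε) ^ 2 := by
    rw [div_le_iff₀ hα0]; linarith
  have hβ0 : 0 ≤ binH ε' / α := by positivity
  have hs2 : √(1 - binH ε' / α) ^ 2 = 1 - binH ε' / α := by
    apply Real.sq_sqrt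
    nlinarith [sq_nonneg (1 - 2 * ε)]
  have hs0 : 0 ≤ √(1 - binH ε' / α) := Real.sqrt_nonneg _
  have hρs : 1 - 2 * ε ≤ √(1 - binH ε' / α) := by
    apply Real.le_sqrt_of_sq_le; linarith
  have hs1 : √(1 - binH ε' / α) ≤ 1 := by
    rw [Real.sqrt_le_iff]; constructor <;> linarith
  generalize √(1 - binH ε' / α) = s at *
  have hb : binH ε' = α * (1 - s ^ 2) := by
    rw [hs2]; field_simp; ring
  rcases eq_or_lt_of_le hρs with heq | hlt
  · rw [heq, sub_self]
    simp only [ne_eq, OfNat.ofNat_ne_zero, not_false_eq_true, zero_pow, mul_zero, zero_div, 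
      zero_mul, neg_zero, Real.rpow_zero]
    rw [dsbs_apply hε0 hε1]
    refine le_trans ?_ (sum_sum_kern ε n).le
    apply Finset.sum_le_sum
    intro x _
    apply Finset.sum_le_sum
    intro y _
    apply mul_le_of_le_one_right (kern_nonneg hε0 hε1 n x y)
    split_ifs <;> norm_num
  · obtain ⟨ρ, rfl⟩ : ∃ ρ, ε = (1 - ρ) / 2 := ⟨1 - 2 * ε, by ring⟩
    have hr : 1 - 2 * ((1 - ρ) / 2) = ρ := by ring
    rw [hr] at hlt
    have hρ0 : 0 ≤ ρ := by linarith
    have hρ1 : ρ < 1 := by linarith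
    have hspos : 0 < s := by linarith
    have h1 : 0 < s - ρ := by linarith
    have h2 : 0 < 1 - ρ ^ 2 := by nlinarith
    have h3 : 0 < 1 - s * ρ := by nlinarith
    have hadm : Adm ((1 - ρ) / 2) (s * (1 - ρ ^ 2) / (s - ρ)) ((1 - ρ ^ 2) / (1 - s * ρ)) := by
      rcases eq_or_lt_of_le hρ0 with h | h
      · left
        subst h
        simp [hspos.ne']
      · right
        refine ⟨by linarith, by linarith, ?_, ?_, ?_, ?_⟩
        · rw [lt_div_iff₀ h1]; nlinarith [mul_pos h h3]
        · rw [lt_div_iff₀ h3]; nlinarith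
        · rw [div_le_iff₀ h3]; nlinarith [sq_nonneg (1 - ρ)]
        · rw [hr]; field_simp; ring
    have ep : 1 / (s * (1 - ρ ^ 2) / (s - ρ)) + 1 / ((1 - ρ ^ 2) / (1 - s * ρ)) - 1 = 
        (s - ρ) * (1 - s * ρ) / (s * (1 - ρ ^ 2)) := by
      field_simp; ring
    have eq' : 1 - 1 / ((1 - ρ ^ 2) / (1 - s * ρ)) = ρ * (s - ρ) / (1 - ρ ^ 2) := by
      field_simp; ring
    have := main_bound hadm hε'0 hε'1 n k (by rw [le_div_iff₀ h3]; nlinarith) 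
      (by rw [ep]; positivity) f g hf
    refine this.trans (le_of_eq ?_)
    rw [ep, eq', ← Real.rpow_add (by norm_num), ← Real.rpow_mul (by norm_num), 
      ← Real.rpow_mul (by norm_num), ← Real.rpow_add (by norm_num), hr, hb]
    congr 1
    have : 4 * ((1 - ρ) / 2) * (1 - (1 - ρ) / 2) = 1 - ρ ^ 2 := by ring
    rw [this]
    field_simp
    ring
end
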